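/- Let a and b be two distinct non-constant polynomials in F_2[t], and set A = ab + b^2 + 1, B = ab(a + b), C = ab, P(x) = A·x^4 + B·x^3 + C·x^2 + 1. With u_n = ⟨W_n⟩ and v_n = ⟨W_n'⟩ for n ≥ 1, the sequence P(u_n/v_n) = (ε_{n−1}·u_n^2·(a+b) + 1)/v_n^4 converges to 0 in F_2((1/t)) as n → ∞, where ε_m = a if m is even and ε_m = b if m is odd. -/

import Mathlib

/-- The continuant `⟨W⟩` of a finite word `W` with letters in a commutative ring,
defined by `⟨∅⟩ = 1`, `⟨w⟩ = w` and `⟨W⟩ = w₁⟨W'⟩ + ⟨(W')'⟩`, where `W'` is `W`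
with its first letter deleted. -/
def continuant {R : Type*} [CommRing R] : List R → R
  | [] => 1
  | [x] => x
  | x :: y :: l => x * continuant (y :: l) + continuant l

/-- The morphism `σ` with `σ(a) = ab`, `σ(b) = aa`, on the abstract two-letter
alphabet `Bool` (where `false` stands for `a` and `true` for `b`), extended to
words by concatenation. -/
def pdStep (l : List Bool) : List Bool :=
  l.flatMap fun x => bif x then [false, false] else [false, true]

/-- The abstract word `Wₙ = (σⁿ(a))''`: the word `σⁿ(a)` with its last letter
removed. -/
def pdWordBool (n : ℕ) : List Bool := (pdStep^[n] [false]).dropLast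

/-- The word `Wₙ = (σⁿ(a))''` with letters the elements `a`, `b` of a ring. -/
def pdWord {R : Type*} (a b : R) (n : ℕ) : List R :=
  (pdWordBool n).map fun x => bif x then b else a

/-- The element `t` of `F₂((1/t))`, realized in `LaurentSeries (ZMod 2)` whose
variable `X` stands for `1/t`; thus `t = X⁻¹` is the Hahn series `single (-1) 1`. -/
noncomputable def tt : LaurentSeries (ZMod 2) := HahnSeries.single (-1 : ℤ) 1

/-- The embedding of `F₂[t]` into `F₂((1/t))`. -/
noncomputable def ι (p : Polynomial (ZMod 2)) : LaurentSeries (ZMod 2) :=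
  Polynomial.aeval tt p

open Polynomial WithZero

/-- The last letter of `σⁿ(a)`. -/
def pdLast : ℕ → Bool
  | 0 => false
  | n + 1 => !pdLast n

theorem pdLast_eq_decide (n : ℕ) : pdLast n = decide (¬ Even n) := by
  induction n with
  | zero => simp [pdLast]
  | succ n ih => by_cases h : Even n <;> simp [pdLast, ih, Nat.even_add_one, h]

theorem pdStep_iterate_append (n : ℕ) (l m : List Bool) :
    pdStep^[n] (l ++ m) = pdStep^[n] l ++ pdStep^[n] m := by
  induction n generalizing l m with
  | zero => rfl
  | succ n ih => simp [Function.iterate_succ_apply, pdStep, ← ih]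

theorem pdStep_iterate_succ_false (n : ℕ) :
    pdStep^[n + 1] [false] = pdStep^[n] [false] ++ pdStep^[n] [true] := by
  rw [← pdStep_iterate_append]; rfl

theorem pdStep_iterate_succ_true (n : ℕ) :
    pdStep^[n + 1] [true] = pdStep^[n] [false] ++ pdStep^[n] [false] := by
  rw [← pdStep_iterate_append]; rfl

theorem pdStep_iterate_eq (n : ℕ) :
    pdStep^[n] [false] = pdWordBool n ++ [pdLast n] ∧
      pdStep^[n] [true] = pdWordBool n ++ [!pdLast n] := by
  induction n with
  | zero => simp [pdWordBool, pdLast]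
  | succ n ih =>
    have h0 := pdStep_iterate_succ_false n
    have h1 := pdStep_iterate_succ_true n
    rw [ih.1, ih.2, ← List.append_assoc] at h0
    rw [ih.1, ← List.append_assoc] at h1
    rw [pdWordBool, h0, h1, List.dropLast_concat]
    simp [pdLast]

theorem pdWordBool_succ (n : ℕ) :
    pdWordBool (n + 1) = pdWordBool n ++ pdLast n :: pdWordBool n := by
  rw [pdWordBool, pdStep_iterate_succ_false, (pdStep_iterate_eq n).1, (pdStep_iterate_eq n).2,
    ← List.append_assoc, List.dropLast_concat]
  simp

/-- The product of the matrices `!![x, 1; 1, 0]` over the letters `x` of a word. -/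
def continuantMatrix {R : Type*} [CommRing R] (l : List R) : Matrix (Fin 2) (Fin 2) R :=
  (l.map fun x => !![x, 1; 1, 0]).prod

theorem continuantMatrix_apply_zero {R : Type*} [CommRing R] (x : R) (l : List R) :
    continuantMatrix (x :: l) 0 0 = continuant (x :: l) ∧
      continuantMatrix (x :: l) 1 0 = continuant l := by
  induction l generalizing x with
  | nil => simp [continuantMatrix, continuant]
  | cons y l ih =>
    have h : continuantMatrix (x :: y :: l) = !![x, 1; 1, 0] * continuantMatrix (y :: l) := by
      simp [continuantMatrix]
    rw [h]
    simp [Matrix.mul_apply, Fin.sum_univ_two, ih y, continuant]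

/-- In characteristic two, the continuant matrices of the period-doubling words are symmetric of
determinant one. -/
theorem continuantMatrix_pdWord {R : Type*} [CommRing R] [CharP R 2] (a b : R) (n : ℕ) :
    continuantMatrix (pdWord a b n) 0 1 = continuantMatrix (pdWord a b n) 1 0 ∧
      (continuantMatrix (pdWord a b n)).det = 1 := by
  induction n with
  | zero => simp [pdWord, pdWordBool, continuantMatrix]
  | succ n ih =>
    have h : continuantMatrix (pdWord a b (n + 1)) = continuantMatrix (pdWord a b n) *
        (!![bif pdLast n then b else a, 1; 1, 0] * continuantMatrix (pdWord a b n)) := by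
      simp [continuantMatrix, pdWord, pdWordBool_succ]
    rw [h]
    constructor
    · simp only [Matrix.mul_apply, Fin.sum_univ_two, Matrix.of_apply, Matrix.cons_val',
        Matrix.cons_val_zero, Matrix.cons_val_one, Matrix.cons_val_fin_one, ih.1]
      ring
    · rw [Matrix.det_mul, Matrix.det_mul, ih.2, Matrix.det_fin_two_of]
      simp [CharTwo.neg_eq]

theorem pdWord_eq_cons {R : Type*} (a b : R) (n : ℕ) :
    ∃ l, pdWord a b (n + 1) = a :: l := by
  induction n with
  | zero => exact ⟨[], rfl⟩
  | succ n ih =>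
    obtain ⟨l, hl⟩ := ih
    simp only [pdWord] at hl ⊢
    rw [pdWordBool_succ, List.map_append, hl]
    exact ⟨_, rfl⟩

theorem continuant_pdWord_succ {R : Type*} [CommRing R] [CharP R 2] (a b : R) (n : ℕ) :
    continuant (pdWord a b (n + 2)) =
        (if Even (n + 1) then a else b) * continuant (pdWord a b (n + 1)) ^ 2 ∧
      continuant (pdWord a b (n + 2)).tail =
        (if Even (n + 1) then a else b) * continuant (pdWord a b (n + 1)) *
          continuant (pdWord a b (n + 1)).tail + 1 := by
  have hC (n : ℕ) : continuantMatrix (pdWord a b (n + 1)) 0 0 = continuant (pdWord a b (n + 1)) ∧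
      continuantMatrix (pdWord a b (n + 1)) 1 0 = continuant (pdWord a b (n + 1)).tail := by
    obtain ⟨l, hl⟩ := pdWord_eq_cons a b n
    rw [hl]
    exact continuantMatrix_apply_zero a l
  have h : continuantMatrix (pdWord a b (n + 2)) = continuantMatrix (pdWord a b (n + 1)) *
      (!![if Even (n + 1) then a else b, 1; 1, 0] * continuantMatrix (pdWord a b (n + 1))) := by
    have : (bif pdLast (n + 1) then b else a) = if Even (n + 1) then a else b := by
      rw [pdLast_eq_decide]; split_ifs with h <;> simp [h]
    rw [← this]
    simp [continuantMatrix, pdWord, pdWordBool_succ (n + 1)]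
  obtain ⟨hs, hd⟩ := continuantMatrix_pdWord a b (n + 1)
  rw [Matrix.det_fin_two, hs] at hd
  rw [← (hC (n + 1)).1, ← (hC (n + 1)).2, ← (hC n).1, ← (hC n).2, h]
  have h2 : (2 : R) = 0 := CharTwo.two_eq_zero
  generalize (if Even (n + 1) then a else b) = e
  generalize continuantMatrix (pdWord a b (n + 1)) = M at *
  simp only [Matrix.mul_apply, Fin.sum_univ_two, Matrix.of_apply, Matrix.cons_val',
    Matrix.cons_val_zero, Matrix.cons_val_one, Matrix.cons_val_fin_one, hs]
  constructor
  · linear_combination M 0 0 * M 1 0 * h2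
  · linear_combination hd + M 1 0 ^ 2 * h2

theorem pd_quartic_form_eq {R : Type*} [CommRing R] [CharP R 2] (a b : R) (n : ℕ) :
    (a * b + b ^ 2 + 1) * continuant (pdWord a b (n + 1)) ^ 4 +
        a * b * (a + b) * continuant (pdWord a b (n + 1)) ^ 3 *
          continuant (pdWord a b (n + 1)).tail +
        a * b * continuant (pdWord a b (n + 1)) ^ 2 * continuant (pdWord a b (n + 1)).tail ^ 2 +
        continuant (pdWord a b (n + 1)).tail ^ 4 =
      (if Even n then a else b) * continuant (pdWord a b (n + 1)) ^ 2 * (a + b) + 1 := by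
  have h2 : (2 : R) = 0 := CharTwo.two_eq_zero
  induction n with
  | zero =>
    have h : pdWord a b 1 = [a] := rfl
    simp only [zero_add, h, continuant, List.tail_cons, Even.zero, if_true]
    linear_combination (a ^ 5 * b + a ^ 4 * b ^ 2) * h2
  | succ n ih =>
    rw [(continuant_pdWord_succ a b n).1, (continuant_pdWord_succ a b n).2]
    generalize continuant (pdWord a b (n + 1)) = u at *
    generalize continuant (pdWord a b (n + 1)).tail = v at *
    obtain ⟨e, d, he, hd, hed⟩ : ∃ e d, (if Even (n + 1) then a else b) = e ∧
        (if Even n then a else b) = d ∧ (e = a ∧ d = b ∨ e = b ∧ d = a) := by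
      by_cases h : Even n <;> simp [h, Nat.even_add_one]
    rw [he]
    rw [hd] at ih
    have e4 : (e * u * v + 1) ^ 4 = e ^ 4 * u ^ 4 * v ^ 4 + 1 := by
      linear_combination
        (2 * (e * u * v) ^ 3 + 3 * (e * u * v) ^ 2 + 2 * (e * u * v)) * h2
    have e2 : (e * u * v + 1) ^ 2 = e ^ 2 * u ^ 2 * v ^ 2 + 1 := by
      linear_combination (e * u * v) * h2
    rw [e4, e2]
    rcases hed with ⟨rfl, rfl⟩ | ⟨rfl, rfl⟩
    · linear_combination e ^ 4 * u ^ 4 * ih + (e ^ 5 * d * u ^ 6 + e ^ 4 * d ^ 2 * u ^ 6) * h2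
    · linear_combination e ^ 4 * u ^ 4 * ih + (e ^ 5 * d * u ^ 6 + e ^ 4 * d ^ 2 * u ^ 6) * h2

theorem degree_continuant_pdWord {K : Type*} [Field K] [CharP K 2] {a b : K[X]}
    (ha : 0 < a.natDegree) (hb : 0 < b.natDegree) (n : ℕ) :
    continuant (pdWord a b (n + 1)) ≠ 0 ∧ continuant (pdWord a b (n + 1)).tail ≠ 0 ∧
      n < (continuant (pdWord a b (n + 1))).natDegree ∧
      (continuant (pdWord a b (n + 1)).tail).natDegree + a.natDegree =
        (continuant (pdWord a b (n + 1))).natDegree := by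
  induction n with
  | zero =>
    have h : pdWord a b 1 = [a] := rfl
    simp only [zero_add, h, continuant, List.tail_cons]
    refine ⟨ne_zero_of_natDegree_gt ha, one_ne_zero, ha, by simp⟩
  | succ n ih =>
    rw [(continuant_pdWord_succ a b n).1, (continuant_pdWord_succ a b n).2]
    generalize continuant (pdWord a b (n + 1)) = u at *
    generalize continuant (pdWord a b (n + 1)).tail = v at *
    obtain ⟨hu, hv, hn, huv⟩ := ih
    have he : 0 < (if Even (n + 1) then a else b).natDegree := by split_ifs <;> assumption
    generalize (if Even (n + 1) then a else b) = e at *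
    have he0 : e ≠ 0 := ne_zero_of_natDegree_gt he
    have h1 : (e * u ^ 2).natDegree = e.natDegree + 2 * u.natDegree := by
      rw [natDegree_mul he0 (pow_ne_zero 2 hu), natDegree_pow]
    have h2 : (e * u * v + 1).natDegree = e.natDegree + u.natDegree + v.natDegree := by
      rw [← C_1, natDegree_add_C, natDegree_mul (mul_ne_zero he0 hu) hv, natDegree_mul he0 hu]
    refine ⟨mul_ne_zero he0 (pow_ne_zero 2 hu),
      ne_zero_of_natDegree_gt (n := 0) (by omega), by omega, by omega⟩

theorem valuation_iota {p : (ZMod 2)[X]} (hp : p ≠ 0) :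
    Valued.v (ι p) = exp (p.natDegree : ℤ) := by
  have htt : Valued.v tt = exp (1 : ℤ) := by
    have h := LaurentSeries.valuation_single_zpow (ZMod 2) (-1)
    rwa [neg_neg] at h
  have : (Valued.v : Valuation (LaurentSeries (ZMod 2)) ℤᵐ⁰).IsTrivialOn (ZMod 2) := by
    refine ⟨fun x hx => ?_⟩
    have : x = 1 := by
      revert x; decide
    rw [this, map_one, map_one]
  rw [ι, Polynomial.valuation_aeval_eq_valuation_X_pow_natDegree_of_one_lt_valuation_X, htt]
  · rw [← exp_nsmul]; simp
  · rw [htt, ← exp_zero, exp_lt_exp]; norm_num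
  · exact hp

theorem valuation_iota_le (p : (ZMod 2)[X]) : Valued.v (ι p) ≤ exp (p.natDegree : ℤ) := by
  rcases eq_or_ne p 0 with rfl | hp
  · simp [ι]
  · exact (valuation_iota hp).le

theorem tendsto_zero_of_valuation_le {K : Type*} [Field K] [Valued K ℤᵐ⁰] {f : ℕ → K}
    (c : ℤ) (h : ∀ n : ℕ, Valued.v (f n) ≤ exp (c - n)) :
    Filter.Tendsto f Filter.atTop (nhds 0) := by
  rw [(Valued.hasBasis_nhds_zero _ _).tendsto_right_iff]
  intro γ _
  simp only [Valuation.restrict_lt_iff_lt_embedding, Set.mem_ofPred_eq]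
  generalize hg : MonoidWithZeroHom.ValueGroup₀.embedding γ.1 = g
  have hg0 : g ≠ 0 := by
    rw [← hg]
    exact (_root_.map_ne_zero _).2 γ.ne_zero
  filter_upwards [Filter.eventually_gt_atTop (c - log g).toNat] with n hn
  refine (h n).trans_lt ?_
  rw [← lt_log_iff_exp_lt hg0]
  omega

/-- Let `a ≠ b` be non-constant polynomials in `F₂[t]`, and set `A = ab + b² + 1`,
`B = ab(a+b)`, `C = ab`, `P(x) = A·x⁴ + B·x³ + C·x² + 1`.  With `uₙ = ⟨Wₙ⟩` and
`vₙ = ⟨Wₙ'⟩` for `n ≥ 1`, the sequence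
`P(uₙ/vₙ) = (ε_{n−1}·uₙ²·(a+b) + 1)/vₙ⁴` converges to `0` in `F₂((1/t))` as
`n → ∞`, where `εₘ = a` if `m` is even and `εₘ = b` if `m` is odd. -/
theorem pd_P_of_convergents_tendsto_zero
    (a b : Polynomial (ZMod 2)) (hab : a ≠ b)
    (ha : 0 < a.natDegree) (hb : 0 < b.natDegree)
    (u v : ℕ → Polynomial (ZMod 2))
    (hu : ∀ n, u n = continuant (pdWord a b n))
    (hv : ∀ n, v n = continuant (pdWord a b n).tail) :
    (∀ n : ℕ, 1 ≤ n →
        ι (a * b + b ^ 2 + 1) * (ι (u n) / ι (v n)) ^ 4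
            + ι (a * b * (a + b)) * (ι (u n) / ι (v n)) ^ 3
            + ι (a * b) * (ι (u n) / ι (v n)) ^ 2 + 1 =
          (ι (if Even (n - 1) then a else b) * ι (u n) ^ 2 * ι (a + b) + 1) / ι (v n) ^ 4) ∧
      Filter.Tendsto
        (fun n : ℕ =>
          ι (a * b + b ^ 2 + 1) * (ι (u (n + 1)) / ι (v (n + 1))) ^ 4
            + ι (a * b * (a + b)) * (ι (u (n + 1)) / ι (v (n + 1))) ^ 3
            + ι (a * b) * (ι (u (n + 1)) / ι (v (n + 1))) ^ 2 + 1)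
        Filter.atTop (nhds 0) := by
  have hv0 (n : ℕ) : ι (v (n + 1)) ≠ 0 := by
    rw [← (Valued.v : Valuation (LaurentSeries (ZMod 2)) ℤᵐ⁰).ne_zero_iff, hv,
      valuation_iota (degree_continuant_pdWord ha hb n).2.1]
    exact exp_ne_zero
  have key (n : ℕ) :
      ι (a * b + b ^ 2 + 1) * (ι (u (n + 1)) / ι (v (n + 1))) ^ 4
          + ι (a * b * (a + b)) * (ι (u (n + 1)) / ι (v (n + 1))) ^ 3
          + ι (a * b) * (ι (u (n + 1)) / ι (v (n + 1))) ^ 2 + 1 =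
        (ι (if Even n then a else b) * ι (u (n + 1)) ^ 2 * ι (a + b) + 1) / ι (v (n + 1)) ^ 4 := by
    have h := congrArg ι (pd_quartic_form_eq a b n)
    rw [← hu, ← hv] at h
    have hv1 := hv0 n
    simp only [ι, map_add, map_mul, map_pow, map_one] at h hv1 ⊢
    field_simp
    linear_combination h
  refine ⟨fun n hn => ?_, ?_⟩
  · obtain ⟨m, rfl⟩ := Nat.exists_eq_add_of_le' hn
    exact key m
  · simp only [key]
    refine tendsto_zero_of_valuation_le (6 * a.natDegree + 2 * b.natDegree) fun n => ?_
    obtain ⟨-, hvn, hn, huv⟩ := degree_continuant_pdWord ha hb n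
    rw [← hu, ← hv] at huv
    rw [← hu] at hn
    rw [← hv] at hvn
    have hN : ι (if Even n then a else b) * ι (u (n + 1)) ^ 2 * ι (a + b) + 1 =
        ι ((if Even n then a else b) * u (n + 1) ^ 2 * (a + b) + 1) := by
      simp only [ι, map_add, map_mul, map_pow, map_one]
    have hdeg : ((if Even n then a else b) * u (n + 1) ^ 2 * (a + b) + 1).natDegree ≤
        (a.natDegree + b.natDegree) + 2 * (u (n + 1)).natDegree +
          (a.natDegree + b.natDegree) := by
      rw [← C_1, natDegree_add_C]
      refine natDegree_mul_le_of_le (natDegree_mul_le_of_le ?_ natDegree_pow_le) ?_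
      · split_ifs <;> omega
      · exact (natDegree_add_le a b).trans (by omega)
    rw [hN, map_div₀, map_pow, valuation_iota hvn, ← exp_nsmul, div_eq_mul_inv, ← exp_neg]
    refine (mul_le_mul_left (valuation_iota_le _) _).trans ?_
    rw [← exp_add, exp_le_exp]
    simp only [nsmul_eq_mul]
    push_cast
    omega
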